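/- arXiv:2512.17091 — 3 statements merged into one kernel-verified Lean document; each statement's English description precedes it below -/
import Mathlib

section
/- Let S be a countable nonempty state space, A an action space, π : S → A a deterministic policy, P, P̂ : S → A → PMF(S) two transition kernels, r, r̂ : S × A → ℝ two bounded reward functions, γ ∈ [0,1) a discount factor, and ρ ∈ [0,1] a mixing parameter. Set α_r := sup over (s,a) of |r(s,a) − r̂(s,a)| and α_P := sup over (s,a) of Σ_{s'} |P(s,a)(s') − P̂(s,a)(s')|. Define the mixed reward r_ρ(s,a) := (1−ρ)·r(s,a) + ρ·r̂(s,a) and mixed kernel P_ρ(s,a) := the PMF (1−ρ)·P(s,a) + ρ·P̂(s,a). For a kernel Q and reward c, define the H-step value with zero terminal value recursively by V_0^{c,Q}(s) := 0 and V_{k+1}^{c,Q}(s) := c(s, π(s)) + γ · Σ_{s'} Q(s, π(s))(s') · V_k^{c,Q}(s'). Then for every integer H ≥ 1 and every state s, |V_H^{r,P}(s) − V_H^{r_ρ,P_ρ}(s)| ≤ ρ·α_P·H·γ·((1−γ^{H−1})/(1−γ))·(span(r)/2) + ρ·α_r·((1−γ^H)/(1−γ)), where span(r) := sup r − inf r over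 S × A. -/
open scoped ENNReal

/-- Convex mixture `(1-ρ)·p + ρ·q` of two probability mass functions. -/
noncomputable def mixPMF {S : Type*} (ρ : ℝ) (hρ0 : 0 ≤ ρ) (hρ1 : ρ ≤ 1) (p q : PMF S) :
    PMF S :=
  ⟨fun s => ENNReal.ofReal (1 - ρ) * p s + ENNReal.ofReal ρ * q s, by
    have h : ∑' s, (ENNReal.ofReal (1 - ρ) * p s + ENNReal.ofReal ρ * q s) = 1 := by
      rw [ENNReal.tsum_add, ENNReal.tsum_mul_left, ENNReal.tsum_mul_left, p.tsum_coe,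
        q.tsum_coe, mul_one, mul_one, ← ENNReal.ofReal_add (by linarith) hρ0]
      norm_num
    exact h ▸ ENNReal.summable.hasSum⟩

/-- `H`-step value function with zero terminal value, for reward `c`, kernel `Q`,
deterministic policy `π` and discount factor `γ`:
`V 0 = 0`, `V (k+1) s = c (s, π s) + γ * ∑' s', Q s (π s) s' * V k s'`. -/
noncomputable def stepValue {S A : Type*} (π : S → A) (Q : S → A → PMF S)
    (c : S × A → ℝ) (γ : ℝ) : ℕ → S → ℝ
  | 0, _ => 0
  | k + 1, s => c (s, π s) + γ * ∑' s', (Q s (π s) s').toReal * stepValue π Q c γ k s'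

namespace PMF

variable {S : Type*}

theorem summable_toReal (p : PMF S) : Summable fun s => (p s).toReal :=
  ENNReal.summable_toReal p.tsum_coe_ne_top

theorem tsum_toReal (p : PMF S) : ∑' s, (p s).toReal = 1 := by
  rw [← ENNReal.tsum_toReal_eq fun s => p.apply_ne_top s, p.tsum_coe, ENNReal.toReal_one]

theorem summable_toReal_mul (p : PMF S) {f : S → ℝ} {B : ℝ} (hf : ∀ s, |f s| ≤ B) :
    Summable fun s => (p s).toReal * f s := by
  refine (p.summable_toReal.mul_right B).of_norm_bounded fun s => ?_
  rw [Real.norm_eq_abs, abs_mul, abs_of_nonneg ENNReal.toReal_nonneg]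
  exact mul_le_mul_of_nonneg_left (hf s) ENNReal.toReal_nonneg

theorem abs_tsum_toReal_mul_le (p : PMF S) {f : S → ℝ} {B : ℝ} (hf : ∀ s, |f s| ≤ B) :
    |∑' s, (p s).toReal * f s| ≤ B := by
  refine tsum_of_norm_bounded (f := fun s => (p s).toReal * f s)
    (g := fun s => (p s).toReal * B) ?_ fun s => ?_
  · have h := p.summable_toReal.hasSum.mul_right B
    rwa [p.tsum_toReal, one_mul] at h
  · rw [Real.norm_eq_abs, abs_mul, abs_of_nonneg ENNReal.toReal_nonneg]
    exact mul_le_mul_of_nonneg_left (hf s) ENNReal.toReal_nonneg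

theorem tsum_toReal_mul_sub (p : PMF S) {f g : S → ℝ} {B C : ℝ} (hf : ∀ s, |f s| ≤ B)
    (hg : ∀ s, |g s| ≤ C) :
    ∑' s, (p s).toReal * (f s - g s) =
      ∑' s, (p s).toReal * f s - ∑' s, (p s).toReal * g s := by
  rw [← (p.summable_toReal_mul hf).tsum_sub (p.summable_toReal_mul hg)]
  simp only [mul_sub]

theorem tsum_toReal_mul_sub_const (p : PMF S) {f : S → ℝ} {B : ℝ} (hf : ∀ s, |f s| ≤ B)
    (m : ℝ) :
    ∑' s, (p s).toReal * (f s - m) = ∑' s, (p s).toReal * f s - m := by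
  rw [p.tsum_toReal_mul_sub hf fun _ => le_refl |m|, tsum_mul_right, p.tsum_toReal, one_mul]

theorem summable_abs_toReal_sub (p q : PMF S) :
    Summable fun s => |(p s).toReal - (q s).toReal| :=
  (p.summable_toReal.sub q.summable_toReal).abs

theorem tsum_abs_toReal_sub_le_two (p q : PMF S) :
    ∑' s, |(p s).toReal - (q s).toReal| ≤ 2 := by
  calc ∑' s, |(p s).toReal - (q s).toReal|
      ≤ ∑' s, ((p s).toReal + (q s).toReal) := by
        refine (p.summable_abs_toReal_sub q).tsum_le_tsum (fun s => ?_)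
          (p.summable_toReal.add q.summable_toReal)
        have hp : 0 ≤ (p s).toReal := ENNReal.toReal_nonneg
        have hq : 0 ≤ (q s).toReal := ENNReal.toReal_nonneg
        rw [abs_le]
        constructor <;> linarith
    _ = 2 := by
        rw [p.summable_toReal.tsum_add q.summable_toReal, p.tsum_toReal, q.tsum_toReal]
        norm_num

/-- Expectations of a function oscillating by at most `h` around `m` differ by at most
`h` times the `L¹` distance of the mass functions. -/
theorem abs_tsum_toReal_mul_sub_le (p q : PMF S) {f : S → ℝ} {B m h : ℝ}
    (hf : ∀ s, |f s| ≤ B) (hm : ∀ s, |f s - m| ≤ h) :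
    |∑' s, (p s).toReal * f s - ∑' s, (q s).toReal * f s| ≤
      (∑' s, |(p s).toReal - (q s).toReal|) * h := by
  have key : ∑' s, (p s).toReal * f s - ∑' s, (q s).toReal * f s =
      ∑' s, ((p s).toReal - (q s).toReal) * (f s - m) := by
    simp only [sub_mul ((p _).toReal)]
    rw [(p.summable_toReal_mul hm).tsum_sub (q.summable_toReal_mul hm),
      p.tsum_toReal_mul_sub_const hf, q.tsum_toReal_mul_sub_const hf]
    ring
  rw [key]
  refine tsum_of_norm_bounded (f := fun s => ((p s).toReal - (q s).toReal) * (f s - m))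
    ((p.summable_abs_toReal_sub q).hasSum.mul_right h) fun s => ?_
  rw [Real.norm_eq_abs, abs_mul]
  exact mul_le_mul_of_nonneg_left (hm s) (abs_nonneg _)

end PMF

theorem mixPMF_apply_toReal {S : Type*} {ρ : ℝ} (hρ0 : 0 ≤ ρ) (hρ1 : ρ ≤ 1) (p q : PMF S)
    (s : S) :
    (mixPMF ρ hρ0 hρ1 p q s).toReal = (1 - ρ) * (p s).toReal + ρ * (q s).toReal := by
  change (ENNReal.ofReal (1 - ρ) * p s + ENNReal.ofReal ρ * q s).toReal = _
  rw [ENNReal.toReal_add (ENNReal.mul_ne_top ENNReal.ofReal_ne_top (p.apply_ne_top s))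
      (ENNReal.mul_ne_top ENNReal.ofReal_ne_top (q.apply_ne_top s)),
    ENNReal.toReal_mul, ENNReal.toReal_mul, ENNReal.toReal_ofReal (by linarith),
    ENNReal.toReal_ofReal hρ0]

theorem tsum_mixPMF_mul {S : Type*} {ρ : ℝ} (hρ0 : 0 ≤ ρ) (hρ1 : ρ ≤ 1) (p q : PMF S)
    {f : S → ℝ} {B : ℝ} (hf : ∀ s, |f s| ≤ B) :
    ∑' s, (mixPMF ρ hρ0 hρ1 p q s).toReal * f s =
      (1 - ρ) * ∑' s, (p s).toReal * f s + ρ * ∑' s, (q s).toReal * f s := by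
  rw [← tsum_mul_left, ← tsum_mul_left,
    ← ((p.summable_toReal_mul hf).mul_left _).tsum_add ((q.summable_toReal_mul hf).mul_left _)]
  refine tsum_congr fun s => ?_
  rw [mixPMF_apply_toReal]
  ring

theorem geom_quotient_succ {γ : ℝ} (hγ1 : γ < 1) (k : ℕ) :
    (1 - γ ^ (k + 1)) / (1 - γ) = 1 + γ * ((1 - γ ^ k) / (1 - γ)) := by
  have : 1 - γ ≠ 0 := by linarith
  field_simp
  ring

theorem geom_quotient_nonneg {γ : ℝ} (hγ0 : 0 ≤ γ) (hγ1 : γ < 1) (k : ℕ) :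
    0 ≤ (1 - γ ^ k) / (1 - γ) :=
  div_nonneg (sub_nonneg.2 (pow_le_one₀ hγ0 hγ1.le)) (sub_nonneg.2 hγ1.le)

/-- Value functions stay in the interval of the rewards, scaled by the discounted horizon. -/
theorem abs_stepValue_sub_le {S A : Type*} (π : S → A) (Q : S → A → PMF S) {c : S × A → ℝ}
    {γ : ℝ} (hγ0 : 0 ≤ γ) (hγ1 : γ < 1) {m h : ℝ} (hc : ∀ p, |c p - m| ≤ h) (k : ℕ) (s : S) :
    |stepValue π Q c γ k s - (1 - γ ^ k) / (1 - γ) * m| ≤ (1 - γ ^ k) / (1 - γ) * h := by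
  induction k generalizing s with
  | zero => simp [stepValue]
  | succ k ih =>
    rw [geom_quotient_succ hγ1]
    set G := (1 - γ ^ k) / (1 - γ)
    have hB : ∀ s, |stepValue π Q c γ k s| ≤ G * h + |G * m| := fun s => by
      have := abs_sub_abs_le_abs_sub (stepValue π Q c γ k s) (G * m)
      linarith [ih s]
    have hE := (Q s (π s)).abs_tsum_toReal_mul_le ih
    rw [(Q s (π s)).tsum_toReal_mul_sub_const hB] at hE
    calc |stepValue π Q c γ (k + 1) s - (1 + γ * G) * m|
        = |(c (s, π s) - m) +
            γ * (∑' s', (Q s (π s) s').toReal * stepValue π Q c γ k s' - G * m)| := by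
          rw [stepValue]
          congr 1
          ring
      _ ≤ h + γ * (G * h) := by
          refine (abs_add_le _ _).trans (add_le_add (hc _) ?_)
          rw [abs_mul, abs_of_nonneg hγ0]
          exact mul_le_mul_of_nonneg_left hE hγ0
      _ = (1 + γ * G) * h := by ring

theorem abs_stepValue_le {S A : Type*} (π : S → A) (Q : S → A → PMF S) {c : S × A → ℝ}
    {γ : ℝ} (hγ0 : 0 ≤ γ) (hγ1 : γ < 1) {B : ℝ} (hc : ∀ p, |c p| ≤ B) (k : ℕ) (s : S) :
    |stepValue π Q c γ k s| ≤ (1 - γ ^ k) / (1 - γ) * B := by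
  simpa using abs_stepValue_sub_le π Q hγ0 hγ1 (m := 0) (by simpa using hc) k s

theorem abs_stepValue_sub_mixed_le {S A : Type*}
    (π : S → A) (P Phat : S → A → PMF S) {r rhat : S × A → ℝ} {B Bhat : ℝ}
    (hr : ∀ p, |r p| ≤ B) (hrhat : ∀ p, |rhat p| ≤ Bhat)
    {γ : ℝ} (hγ0 : 0 ≤ γ) (hγ1 : γ < 1) {ρ : ℝ} (hρ0 : 0 ≤ ρ) (hρ1 : ρ ≤ 1)
    {αr αP m h : ℝ} (hαr : ∀ p, |r p - rhat p| ≤ αr)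
    (hαP : ∀ p : S × A, ∑' s', |(P p.1 p.2 s').toReal - (Phat p.1 p.2 s').toReal| ≤ αP)
    (hm : ∀ p, |r p - m| ≤ h) (k : ℕ) (s : S) :
    |stepValue π P r γ k s -
        stepValue π (fun s a => mixPMF ρ hρ0 hρ1 (P s a) (Phat s a))
          (fun p => (1 - ρ) * r p + ρ * rhat p) γ k s| ≤
      ρ * αP * k * γ * ((1 - γ ^ (k - 1)) / (1 - γ)) * h +
        ρ * αr * ((1 - γ ^ k) / (1 - γ)) := by
  set Q : S → A → PMF S := fun s a => mixPMF ρ hρ0 hρ1 (P s a) (Phat s a) with hQ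
  set c : S × A → ℝ := fun p => (1 - ρ) * r p + ρ * rhat p with hc
  have hcB : ∀ p, |c p| ≤ (1 - ρ) * B + ρ * Bhat := fun p => by
    refine (abs_add_le _ _).trans ?_
    rw [abs_mul, abs_mul, abs_of_nonneg hρ0, abs_of_nonneg (sub_nonneg.2 hρ1)]
    exact add_le_add (mul_le_mul_of_nonneg_left (hr p) (sub_nonneg.2 hρ1))
      (mul_le_mul_of_nonneg_left (hrhat p) hρ0)
  induction k generalizing s with
  | zero => simp [stepValue]
  | succ k ih =>
    have hG0 := geom_quotient_nonneg hγ0 hγ1 k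
    have hG : γ * ((1 - γ ^ (k - 1)) / (1 - γ)) ≤ (1 - γ ^ k) / (1 - γ) := by
      cases k with
      | zero => simp
      | succ k => rw [geom_quotient_succ hγ1 k, Nat.add_sub_cancel]; linarith
    have hV := abs_stepValue_le π P hγ0 hγ1 hr k
    have hW := abs_stepValue_le π Q hγ0 hγ1 hcB k
    have hh : 0 ≤ h := (abs_nonneg _).trans (hm (s, π s))
    have hα : 0 ≤ αP := (tsum_nonneg fun _ => abs_nonneg _).trans (hαP (s, π s))
    have hdiff := (Q s (π s)).abs_tsum_toReal_mul_le ih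
    rw [(Q s (π s)).tsum_toReal_mul_sub hV hW] at hdiff
    have hosc := ((P s (π s)).abs_tsum_toReal_mul_sub_le (Phat s (π s)) hV
      (abs_stepValue_sub_le π P hγ0 hγ1 hm k)).trans
        (mul_le_mul_of_nonneg_right (hαP (s, π s)) (mul_nonneg hG0 hh))
    have hmix := tsum_mixPMF_mul hρ0 hρ1 (P s (π s)) (Phat s (π s)) hV
    rw [geom_quotient_succ hγ1 k, Nat.add_sub_cancel, Nat.cast_succ, stepValue, stepValue]
    set G := (1 - γ ^ k) / (1 - γ)
    set G' := (1 - γ ^ (k - 1)) / (1 - γ)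
    set x := ∑' s', (P s (π s) s').toReal * stepValue π P r γ k s'
    set y := ∑' s', (Phat s (π s) s').toReal * stepValue π P r γ k s'
    set z := ∑' s', (Q s (π s) s').toReal * stepValue π P r γ k s'
    set w := ∑' s', (Q s (π s) s').toReal * stepValue π Q c γ k s'
    have hz : z = (1 - ρ) * x + ρ * y := hmix
    calc |r (s, π s) + γ * x - (c (s, π s) + γ * w)|
        = |ρ * (r (s, π s) - rhat (s, π s)) + (γ * ρ * (x - y) + γ * (z - w))| := by
          rw [hz, hc]
          congr 1
          ring
      _ ≤ ρ * αr + (γ * ρ * (αP * (G * h)) + γ * (ρ * αP * k * γ * G' * h + ρ * αr * G)) := by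
          refine (abs_add_le _ _).trans (add_le_add ?_ ((abs_add_le _ _).trans
            (add_le_add ?_ ?_)))
          · rw [abs_mul, abs_of_nonneg hρ0]
            exact mul_le_mul_of_nonneg_left (hαr _) hρ0
          · rw [abs_mul, abs_of_nonneg (mul_nonneg hγ0 hρ0)]
            exact mul_le_mul_of_nonneg_left hosc (mul_nonneg hγ0 hρ0)
          · rw [abs_mul, abs_of_nonneg hγ0]
            exact mul_le_mul_of_nonneg_left hdiff hγ0
      _ ≤ ρ * αP * (k + 1) * γ * G * h + ρ * αr * (1 + γ * G) := by
          have hcoef : 0 ≤ ρ * αP * k * γ * h := by positivity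
          linarith [mul_le_mul_of_nonneg_left hG hcoef]

/-- **H-step simulation lemma.**  Mixing the reward and transition kernel of an MDP with an
approximate reward `r̂` (uniform error `α_r`) and kernel `P̂` (uniform `L¹` error `α_P`) with
mixing parameter `ρ` perturbs the `H`-step value function (under a deterministic policy `π`,
with zero terminal value) by at most
`ρ·α_P·H·γ·((1-γ^(H-1))/(1-γ))·span(r)/2 + ρ·α_r·((1-γ^H)/(1-γ))`. -/
theorem value_error_mixed_model
    {S A : Type*} [Countable S] [Nonempty S]
    (π : S → A) (P Phat : S → A → PMF S) (r rhat : S × A → ℝ)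
    (hr : ∃ B, ∀ p, |r p| ≤ B) (hrhat : ∃ B, ∀ p, |rhat p| ≤ B)
    (γ : ℝ) (hγ0 : 0 ≤ γ) (hγ1 : γ < 1)
    (ρ : ℝ) (hρ0 : 0 ≤ ρ) (hρ1 : ρ ≤ 1)
    (αr αP : ℝ)
    (hαr : αr = ⨆ p : S × A, |r p - rhat p|)
    (hαP : αP = ⨆ p : S × A, ∑' s' : S, |(P p.1 p.2 s').toReal - (Phat p.1 p.2 s').toReal|)
    (H : ℕ) (hH : 1 ≤ H) (s : S) :
    |stepValue π P r γ H s -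
        stepValue π (fun s a => mixPMF ρ hρ0 hρ1 (P s a) (Phat s a))
          (fun p => (1 - ρ) * r p + ρ * rhat p) γ H s| ≤
      ρ * αP * H * γ * ((1 - γ ^ (H - 1)) / (1 - γ)) *
          (((⨆ p : S × A, r p) - ⨅ p : S × A, r p) / 2) +
        ρ * αr * ((1 - γ ^ H) / (1 - γ)) := by
  obtain ⟨B, hB⟩ := hr
  obtain ⟨Bhat, hBhat⟩ := hrhat
  have hup : BddAbove (Set.range r) :=
    ⟨B, Set.forall_mem_range.2 fun p => (abs_le.1 (hB p)).2⟩
  have hlow : BddBelow (Set.range r) :=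
    ⟨-B, Set.forall_mem_range.2 fun p => (abs_le.1 (hB p)).1⟩
  have hrew : BddAbove (Set.range fun p => |r p - rhat p|) :=
    ⟨B + Bhat, Set.forall_mem_range.2 fun p =>
      (abs_sub (r p) (rhat p)).trans (add_le_add (hB p) (hBhat p))⟩
  have hker : BddAbove (Set.range fun p : S × A =>
      ∑' s' : S, |(P p.1 p.2 s').toReal - (Phat p.1 p.2 s').toReal|) :=
    ⟨2, Set.forall_mem_range.2 fun p => (P p.1 p.2).tsum_abs_toReal_sub_le_two (Phat p.1 p.2)⟩
  refine abs_stepValue_sub_mixed_le π P Phat hB hBhat hγ0 hγ1 hρ0 hρ1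
    (fun p => hαr ▸ le_ciSup hrew p) (fun p => hαP ▸ le_ciSup hker p)
    (m := ((⨆ p : S × A, r p) + ⨅ p : S × A, r p) / 2) (fun p => ?_) H s
  have h1 := le_ciSup hup p
  have h2 := ciInf_le hlow p
  rw [abs_le]
  constructor <;> linarith
end

section
/- Let S be a countable type, let p, q be PMFs on S, and let g : S → ℝ be bounded. Then the expectations Σ_s p(s)·g(s) and Σ_s q(s)·g(s) converge absolutely and |Σ_{s∈S} p(s)·g(s) − Σ_{s∈S} q(s)·g(s)| ≤ span(g) · (1/2) · Σ_{s∈S} |p(s) − q(s)|, where span(g) := sup g − inf g. -/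
open scoped ENNReal

/-- **Total-variation bound on expectations.**  For PMFs `p, q` on a countable type and a
bounded function `g`, both expectations converge absolutely and their difference is bounded
by `span(g)` times half the `L¹` distance between `p` and `q`. -/
theorem expectation_diff_le_span_mul_tv
    {S : Type*} [Countable S] (p q : PMF S) (g : S → ℝ) (hg : ∃ B, ∀ s, |g s| ≤ B) :
    Summable (fun s => |(p s).toReal * g s|) ∧
      Summable (fun s => |(q s).toReal * g s|) ∧
      |(∑' s, (p s).toReal * g s) - ∑' s, (q s).toReal * g s| ≤
        ((⨆ s, g s) - ⨅ s, g s) * (2⁻¹ * ∑' s, |(p s).toReal - (q s).toReal|) := by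
  obtain ⟨B, hB⟩ := hg
  have hsum (r : PMF S) : HasSum (fun s => (r s).toReal) 1 := by
    have h := ENNReal.hasSum_toReal (f := r) (by simp [r.tsum_coe])
    simpa [← ENNReal.tsum_toReal_eq r.apply_ne_top, r.tsum_coe] using h
  have habs (r : PMF S) : Summable fun s => |(r s).toReal * g s| := by
    refine .of_nonneg_of_le (fun _ => abs_nonneg _) (fun s => ?_) ((hsum r).summable.mul_right B)
    rw [abs_mul, abs_of_nonneg ENNReal.toReal_nonneg]
    gcongr
    exact hB s
  refine ⟨habs p, habs q, ?_⟩
  have hbdd_above : BddAbove (Set.range g) :=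
    ⟨B, Set.forall_mem_range.2 fun s => (abs_le.1 (hB s)).2⟩
  have hbdd_below : BddBelow (Set.range g) :=
    ⟨-B, Set.forall_mem_range.2 fun s => (abs_le.1 (hB s)).1⟩
  set M := ⨆ s, g s
  set m := ⨅ s, g s
  have hcenter (s : S) : |g s - (M + m) / 2| ≤ (M - m) / 2 := by
    have hM : g s ≤ M := le_ciSup hbdd_above s
    have hm : m ≤ g s := ciInf_le hbdd_below s
    rw [abs_le]
    constructor <;> linarith
  have hdiff : HasSum (fun s => ((p s).toReal - (q s).toReal) * (g s - (M + m) / 2))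
      ((∑' s, (p s).toReal * g s) - ∑' s, (q s).toReal * g s) := by
    have h := ((habs p).of_abs.hasSum.sub (habs q).of_abs.hasSum).sub
      (((hsum p).sub (hsum q)).mul_right ((M + m) / 2))
    rw [sub_self, zero_mul, sub_zero] at h
    exact h.congr_fun fun s => by ring
  have htv : Summable fun s => |(p s).toReal - (q s).toReal| :=
    ((hsum p).summable.sub (hsum q).summable).abs
  rw [← hdiff.tsum_eq, ← mul_assoc, mul_comm, ← Real.norm_eq_abs]
  refine tsum_of_norm_bounded (htv.hasSum.mul_right ((M - m) * 2⁻¹)) fun s => ?_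
  rw [Real.norm_eq_abs, abs_mul, ← div_eq_mul_inv]
  gcongr
  exact hcenter s
end

section
/- Let λ ∈ [0,1), let c ∈ (0,1], let (ω_t)_{t∈ℕ} satisfy c ≤ ω_t ≤ 1 for all t, let Ω_0 ∈ [c,1] and ρ_0 ≥ 0, and define recursively Ω_{t+1} := λ·Ω_t + (1−λ)·ω_t, η_t := (1−λ)·Ω_{t+1}, and ρ_{t+1} := max(0, ρ_t·(1−η_t)). Then Ω_t ≥ c for all t, η_t ≥ (1−λ)·c for all t, ρ_t ≤ ρ_0·(1 − (1−λ)·c)^t for all t, and hence ρ_t → 0 as t → ∞. -/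
open Filter

/-- **Annealing of the influence ratio to zero under bounded uncertainty.**
With smoothing factor `λ ∈ [0,1)`, instantaneous scores `ω t ∈ [c,1]` for some `c ∈ (0,1]`,
EMA `Ω (t+1) = λ·Ω t + (1-λ)·ω t` started at `Ω 0 ∈ [c,1]`, update rate
`η t = (1-λ)·Ω (t+1)`, and `ρ (t+1) = max 0 (ρ t · (1 - η t))` with `ρ 0 ≥ 0`:
`Ω t ≥ c` and `η t ≥ (1-λ)·c` for all `t`, `ρ t ≤ ρ 0 · (1 - (1-λ)·c)^t` for all `t`,
and hence `ρ t → 0` as `t → ∞`. -/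
theorem influence_ratio_tendsto_zero
    (lam : ℝ) (hlam0 : 0 ≤ lam) (hlam1 : lam < 1)
    (c : ℝ) (hc0 : 0 < c) (hc1 : c ≤ 1)
    (ω Ω η ρ : ℕ → ℝ)
    (hω : ∀ t, ω t ∈ Set.Icc c 1)
    (hΩ0 : Ω 0 ∈ Set.Icc c 1) (hρ0 : 0 ≤ ρ 0)
    (hΩ : ∀ t, Ω (t + 1) = lam * Ω t + (1 - lam) * ω t)
    (hη : ∀ t, η t = (1 - lam) * Ω (t + 1))
    (hρ : ∀ t, ρ (t + 1) = max 0 (ρ t * (1 - η t))) :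
    (∀ t, c ≤ Ω t) ∧ (∀ t, (1 - lam) * c ≤ η t) ∧
      (∀ t, ρ t ≤ ρ 0 * (1 - (1 - lam) * c) ^ t) ∧
      Tendsto ρ atTop (nhds 0) := by
  have hΩc : ∀ t, c ≤ Ω t := by
    intro t
    induction t with
    | zero => exact hΩ0.1
    | succ t ih =>
      rw [hΩ]
      nlinarith [mul_le_mul_of_nonneg_left ih hlam0,
        mul_le_mul_of_nonneg_left (hω t).1 (sub_nonneg.2 hlam1.le)]
  have hηc : ∀ t, (1 - lam) * c ≤ η t := fun t => by
    rw [hη]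
    exact mul_le_mul_of_nonneg_left (hΩc (t + 1)) (sub_nonneg.2 hlam1.le)
  have hρ_nonneg : ∀ t, 0 ≤ ρ t
    | 0 => hρ0
    | t + 1 => by rw [hρ]; exact le_max_left _ _
  have hrate_pos : 0 < (1 - lam) * c := mul_pos (sub_pos.2 hlam1) hc0
  have hrate_le : (1 - lam) * c ≤ 1 := mul_le_one₀ (by linarith) hc0.le hc1
  have hq : 0 ≤ 1 - (1 - lam) * c := sub_nonneg.2 hrate_le
  have hbound : ∀ t, ρ t ≤ ρ 0 * (1 - (1 - lam) * c) ^ t := by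
    intro t
    induction t with
    | zero => simp
    | succ t ih =>
      rw [hρ]
      refine max_le (mul_nonneg hρ0 (pow_nonneg hq _)) ?_
      calc ρ t * (1 - η t) ≤ ρ t * (1 - (1 - lam) * c) :=
            mul_le_mul_of_nonneg_left (sub_le_sub_left (hηc t) 1) (hρ_nonneg t)
        _ ≤ ρ 0 * (1 - (1 - lam) * c) ^ t * (1 - (1 - lam) * c) :=
            mul_le_mul_of_nonneg_right ih hq
        _ = ρ 0 * (1 - (1 - lam) * c) ^ (t + 1) := by ring
  refine ⟨hΩc, hηc, hbound, squeeze_zero hρ_nonneg hbound ?_⟩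
  simpa using (tendsto_pow_atTop_nhds_zero_of_lt_one hq (by linarith)).const_mul (ρ 0)
end
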